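/- arXiv:2112.02493 — 2 statements merged into one kernel-verified Lean document; each statement's English description precedes it below -/
import Mathlib

section
/- Let x̂ = (…, x_2, x_1) ∈ X+ be such that x_m ≤ p_m for all m ≥ 1, and let k ≥ 1. Then c_{k+2l}·x_k − c_{k+2l−1}·x_{k+1} ≥ 0 for all l ≥ 1 if and only if γ_k·x_k − x_{k+1} ≥ 0. -/
open Filter Function

namespace HypCrystal

variable (a1 a2 k1 k2 : ℤ)

/-- `i_k`: 1 if `k` is odd, 2 if `k` is even. -/
def idx (k : ℤ) : ℤ := if k % 2 = 1 then 1 else 2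

/-- membership in the index set `I = {1,2}`. -/
def IsI (i : ℤ) : Prop := i = 1 ∨ i = 2

/-- `⟨α_{i_j}, α_{i_k}^∨⟩`. -/
def pairJK (j k : ℤ) : ℤ :=
  if j % 2 = k % 2 then 2 else if k % 2 = 1 then -a1 else -a2

/-- `⟨α_{i_j}, α_i^∨⟩` for `i ∈ {1,2}`. -/
def pairJI (j i : ℤ) : ℤ :=
  if idx j = i then 2 else if i = 1 then -a1 else -a2

/-- `α_{i_j}` in the `(Λ1, Λ2)`-coordinates. -/
def alphaOf (j : ℤ) : ℤ × ℤ := if j % 2 = 1 then (2, -a2) else (-a1, 2)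

/-- `⟨ν, α_i^∨⟩` for a weight `ν` in `(Λ1, Λ2)`-coordinates. -/
def pairW (ν : ℤ × ℤ) (i : ℤ) : ℤ := if i = 1 then ν.1 else ν.2

/-- the sequence `c_j`. -/
def cseq : ℕ → ℤ
  | 0 => 0
  | 1 => 1
  | j + 2 => (if j % 2 = 0 then a1 else a2) * cseq (j + 1) - cseq j

/-- the sequence `c'_j`. -/
def cseq' : ℕ → ℤ
  | 0 => 0
  | 1 => 1
  | j + 2 => (if j % 2 = 0 then a2 else a1) * cseq' (j + 1) - cseq' j

noncomputable def alphaR : ℝ :=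
  ((a1 : ℝ) * a2 + Real.sqrt ((a1 : ℝ) ^ 2 * (a2 : ℝ) ^ 2 - 4 * a1 * a2)) / (2 * a2)

noncomputable def betaR : ℝ :=
  ((a1 : ℝ) * a2 + Real.sqrt ((a1 : ℝ) ^ 2 * (a2 : ℝ) ^ 2 - 4 * a1 * a2)) / (2 * a1)

/-- `γ_k = α` if `k` even, `β` if `k` odd. -/
noncomputable def gammaR (k : ℤ) : ℝ := if k % 2 = 0 then alphaR a1 a2 else betaR a1 a2

/-- `p_m` for `m ≥ 0`. -/
def ppos : ℕ → ℤ
  | 0 => k2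
  | 1 => k1
  | m + 2 => (if m % 2 = 0 then a2 else a1) * ppos (m + 1) - ppos m

/-- `p_{-n}` for `n ≥ 0`. -/
def pneg : ℕ → ℤ
  | 0 => k2
  | 1 => a1 * k2 - k1
  | n + 2 => (if (n + 2) % 2 = 0 then a2 else a1) * pneg (n + 1) - pneg n

/-- the two-sided sequence `p_m`, `m ∈ ℤ`, with `p_0 = k2`, `p_1 = k1`. -/
def pseq (m : ℤ) : ℤ :=
  if 0 ≤ m then ppos a1 a2 k1 k2 m.toNat else pneg a1 a2 k1 k2 (-m).toNat

/-- `λ = k1·Λ1 − k2·Λ2` in `(Λ1, Λ2)`-coordinates. -/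
def lamW : ℤ × ℤ := (k1, -k2)

/-- membership in `ℤ^{+∞}` (coordinates supported on positions `≥ 1`, nonnegative,
finitely supported). -/
def ZPlusMem (x : ℤ → ℤ) : Prop :=
  (∀ k : ℤ, k ≤ 0 → x k = 0) ∧ (∀ k : ℤ, 0 ≤ x k) ∧ ∃ N : ℕ, ∀ k : ℤ, (N : ℤ) < k → x k = 0

/-- membership in `ℤ^{−∞}` (coordinates supported on positions `≤ 0`, nonpositive,
finitely supported). -/
def ZMinusMem (x : ℤ → ℤ) : Prop :=
  (∀ k : ℤ, 1 ≤ k → x k = 0) ∧ (∀ k : ℤ, x k ≤ 0) ∧ ∃ N : ℕ, ∀ k : ℤ, k < -(N : ℤ) → x k = 0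

/-- membership in `X+ = Img(Ψ⁺)`. -/
def XPlusMem (x : ℤ → ℤ) : Prop :=
  ZPlusMem x ∧ ∀ j : ℤ, 1 ≤ j →
    0 ≤ cseq a1 a2 j.toNat * x j - cseq a1 a2 (j - 1).toNat * x (j + 1)

/-- membership in `X− = Img(Ψ⁻)`. -/
def XMinusMem (x : ℤ → ℤ) : Prop :=
  ZMinusMem x ∧ ∀ j : ℤ, j ≤ 0 →
    cseq' a1 a2 (1 - j).toNat * x j - cseq' a1 a2 (-j).toNat * x (j - 1) ≤ 0

def posPart (x : ℤ → ℤ) : ℤ → ℤ := fun k => if 1 ≤ k then x k else 0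
def negPart (x : ℤ → ℤ) : ℤ → ℤ := fun k => if k ≤ 0 then x k else 0

/-- membership in `Z_ι(μ) = ℤ^{+∞} ⊗ t_μ ⊗ ℤ^{−∞}` (in coordinates). -/
def ZMem (x : ℤ → ℤ) : Prop := ZPlusMem (posPart x) ∧ ZMinusMem (negPart x)

/-- membership in `X+ ⊗ t_λ ⊗ X−` (in coordinates). -/
def XXMem (x : ℤ → ℤ) : Prop := XPlusMem a1 a2 (posPart x) ∧ XMinusMem a1 a2 (negPart x)

/-- `σ_k` on `ℤ^{+∞}` (for `k ≥ 1`). -/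
noncomputable def sigmaP (x : ℤ → ℤ) (k : ℤ) : ℤ :=
  x k + ∑ᶠ j : ℤ, if k < j then pairJK a1 a2 j k * x j else 0

/-- `σ_k` on `ℤ^{−∞}` (for `k ≤ 0`). -/
noncomputable def sigmaM (x : ℤ → ℤ) (k : ℤ) : ℤ :=
  -(x k) - ∑ᶠ j : ℤ, if j < k then pairJK a1 a2 j k * x j else 0

/-- `−Σ_j x_j α_{i_j}` in `(Λ1, Λ2)`-coordinates. -/
noncomputable def wtOf (x : ℤ → ℤ) : ℤ × ℤ :=
  (-∑ᶠ j : ℤ, x j * (alphaOf a1 a2 j).1, -∑ᶠ j : ℤ, x j * (alphaOf a1 a2 j).2)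

/-- `wt(x) = μ − Σ_j x_j α_{i_j}`. -/
noncomputable def wtZ (μ : ℤ × ℤ) (x : ℤ → ℤ) : ℤ × ℤ := μ + wtOf a1 a2 x

/-- `σ_k` on `Z_ι(μ)`. -/
noncomputable def sigmaZ (μ : ℤ × ℤ) (x : ℤ → ℤ) (k : ℤ) : ℤ :=
  if 1 ≤ k then sigmaP a1 a2 x k
  else sigmaM a1 a2 x k - pairW (wtZ a1 a2 μ x) (idx k)

/-- `ε_i` on `Z_ι(μ)`. -/
noncomputable def epsZ (μ : ℤ × ℤ) (x : ℤ → ℤ) (i : ℤ) : ℤ :=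
  sSup {s : ℤ | ∃ k : ℤ, idx k = i ∧ sigmaZ a1 a2 μ x k = s}

/-- `φ_i` on `Z_ι(μ)`. -/
noncomputable def phiZ (μ : ℤ × ℤ) (x : ℤ → ℤ) (i : ℤ) : ℤ :=
  epsZ a1 a2 μ x i + pairW (wtZ a1 a2 μ x) i

noncomputable def kmaxZ (μ : ℤ × ℤ) (x : ℤ → ℤ) (i : ℤ) : ℤ :=
  sSup {k : ℤ | idx k = i ∧ sigmaZ a1 a2 μ x k = epsZ a1 a2 μ x i}

noncomputable def kminZ (μ : ℤ × ℤ) (x : ℤ → ℤ) (i : ℤ) : ℤ :=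
  sInf {k : ℤ | idx k = i ∧ sigmaZ a1 a2 μ x k = epsZ a1 a2 μ x i}

/-- `ẽ_i` on `Z_ι(μ)`; `none` represents `0`. -/
noncomputable def eZ (μ : ℤ × ℤ) (i : ℤ) (x : ℤ → ℤ) : Option (ℤ → ℤ) :=
  if 0 < epsZ a1 a2 μ x i then
    some (Function.update x (kmaxZ a1 a2 μ x i) (x (kmaxZ a1 a2 μ x i) - 1))
  else none

/-- `f̃_i` on `Z_ι(μ)`; `none` represents `0`. -/
noncomputable def fZ (μ : ℤ × ℤ) (i : ℤ) (x : ℤ → ℤ) : Option (ℤ → ℤ) :=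
  if 0 < phiZ a1 a2 μ x i then
    some (Function.update x (kminZ a1 a2 μ x i) (x (kminZ a1 a2 μ x i) + 1))
  else none

/-- `ε_i` on `ℤ^{+∞}`. -/
noncomputable def epsP (x : ℤ → ℤ) (i : ℤ) : ℤ :=
  sSup {s : ℤ | ∃ k : ℤ, 1 ≤ k ∧ idx k = i ∧ sigmaP a1 a2 x k = s}

noncomputable def kmaxP (x : ℤ → ℤ) (i : ℤ) : ℤ :=
  sSup {k : ℤ | 1 ≤ k ∧ idx k = i ∧ sigmaP a1 a2 x k = epsP a1 a2 x i}

noncomputable def kminP (x : ℤ → ℤ) (i : ℤ) : ℤ :=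
  sInf {k : ℤ | 1 ≤ k ∧ idx k = i ∧ sigmaP a1 a2 x k = epsP a1 a2 x i}

/-- `ẽ_i` on `ℤ^{+∞}` (partial). -/
noncomputable def eP (i : ℤ) (x : ℤ → ℤ) : Option (ℤ → ℤ) :=
  if 0 < epsP a1 a2 x i then
    some (Function.update x (kmaxP a1 a2 x i) (x (kmaxP a1 a2 x i) - 1))
  else none

/-- `f̃_i` on `ℤ^{+∞}` (total). -/
noncomputable def fP (i : ℤ) (x : ℤ → ℤ) : ℤ → ℤ :=
  Function.update x (kminP a1 a2 x i) (x (kminP a1 a2 x i) + 1)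

/-- `φ_i` on `ℤ^{−∞}`. -/
noncomputable def phiMf (x : ℤ → ℤ) (i : ℤ) : ℤ :=
  sSup {s : ℤ | ∃ k : ℤ, k ≤ 0 ∧ idx k = i ∧ sigmaM a1 a2 x k = s}

noncomputable def kmaxM (x : ℤ → ℤ) (i : ℤ) : ℤ :=
  sSup {k : ℤ | k ≤ 0 ∧ idx k = i ∧ sigmaM a1 a2 x k = phiMf a1 a2 x i}

noncomputable def kminM (x : ℤ → ℤ) (i : ℤ) : ℤ :=
  sInf {k : ℤ | k ≤ 0 ∧ idx k = i ∧ sigmaM a1 a2 x k = phiMf a1 a2 x i}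

/-- `ẽ_i` on `ℤ^{−∞}` (total). -/
noncomputable def eM (i : ℤ) (x : ℤ → ℤ) : ℤ → ℤ :=
  Function.update x (kmaxM a1 a2 x i) (x (kmaxM a1 a2 x i) - 1)

noncomputable def fPiter (i : ℤ) (n : ℕ) (x : ℤ → ℤ) : ℤ → ℤ := (fP a1 a2 i)^[n] x

noncomputable def eMiter (i : ℤ) (n : ℕ) (x : ℤ → ℤ) : ℤ → ℤ := (eM a1 a2 i)^[n] x

noncomputable def ePiterO (i : ℤ) (n : ℕ) (ox : Option (ℤ → ℤ)) : Option (ℤ → ℤ) :=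
  (fun o => o.bind (eP a1 a2 i))^[n] ox

noncomputable def eZiterO (μ : ℤ × ℤ) (i : ℤ) (n : ℕ) (ox : Option (ℤ → ℤ)) : Option (ℤ → ℤ) :=
  (fun o => o.bind (eZ a1 a2 μ i))^[n] ox

noncomputable def fZiterO (μ : ℤ × ℤ) (i : ℤ) (n : ℕ) (ox : Option (ℤ → ℤ)) : Option (ℤ → ℤ) :=
  (fun o => o.bind (fZ a1 a2 μ i))^[n] ox

noncomputable def suppBoundP (x : ℤ → ℤ) : ℕ := sInf {N : ℕ | ∀ k : ℤ, (N : ℤ) < k → x k = 0}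

noncomputable def suppBoundM (x : ℤ → ℤ) : ℕ := sInf {N : ℕ | ∀ k : ℤ, k < -(N : ℤ) → x k = 0}

/-- `starPChain x n z = f̃_{i_1}^{x_1} ⋯ f̃_{i_n}^{x_n} (z)` on `ℤ^{+∞}`. -/
noncomputable def starPChain (x : ℤ → ℤ) : ℕ → (ℤ → ℤ) → (ℤ → ℤ)
  | 0, z => z
  | n + 1, z => starPChain x n (fPiter a1 a2 (idx ((n : ℤ) + 1)) ((x ((n : ℤ) + 1)).toNat) z)

/-- the `∗`-operation on `X+`: `(x⁺)* = f̃_{i_1}^{x_1} ⋯ f̃_{i_N}^{x_N} (z_∞)`. -/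
noncomputable def starP (x : ℤ → ℤ) : ℤ → ℤ :=
  starPChain a1 a2 x (suppBoundP x) (fun _ => 0)

/-- `starMChain x n z = ẽ_{i_0}^{−x_0} ⋯ ẽ_{i_{-(n-1)}}^{−x_{-(n-1)}} (z)` on `ℤ^{−∞}`. -/
noncomputable def starMChain (x : ℤ → ℤ) : ℕ → (ℤ → ℤ) → (ℤ → ℤ)
  | 0, z => z
  | n + 1, z => starMChain x n (eMiter a1 a2 (idx (-(n : ℤ))) ((-(x (-(n : ℤ)))).toNat) z)

/-- the `∗`-operation on `X−`. -/
noncomputable def starM (x : ℤ → ℤ) : ℤ → ℤ :=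
  starMChain a1 a2 x (suppBoundM x + 1) (fun _ => 0)

/-- combine a `ℤ^{+∞}`- and a `ℤ^{−∞}`-component into an element of `Z_ι(μ)`. -/
def combine (y z : ℤ → ℤ) : ℤ → ℤ := fun k => if 1 ≤ k then y k else z k

/-- the coordinates of `x* = (x⁺)* ⊗ t_μ ⊗ (x⁻)*`. -/
noncomputable def xstarFun (x : ℤ → ℤ) : ℤ → ℤ :=
  combine (starP a1 a2 (posPart x)) (starM a1 a2 (negPart x))

/-- the weight `μ = −λ − wt(x⁺) − wt(x⁻)` of `x*`. -/
noncomputable def mustar (lam : ℤ × ℤ) (x : ℤ → ℤ) : ℤ × ℤ :=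
  -lam - wtOf a1 a2 (posPart x) - wtOf a1 a2 (negPart x)

/-- `fPnegChain g n z = f̃_{i_{-(n-1)}}^{g(-(n-1))} ⋯ f̃_{i_{-1}}^{g(-1)} f̃_{i_0}^{g 0} (z)`. -/
noncomputable def fPnegChain (g : ℤ → ℕ) : ℕ → (ℤ → ℤ) → (ℤ → ℤ)
  | 0, z => z
  | n + 1, z => fPiter a1 a2 (idx (-(n : ℤ))) (g (-(n : ℤ))) (fPnegChain g n z)

/-- `eMposChain g n z = ẽ_{i_n}^{g n} ⋯ ẽ_{i_2}^{g 2} ẽ_{i_1}^{g 1} (z)`. -/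
noncomputable def eMposChain (g : ℤ → ℕ) : ℕ → (ℤ → ℤ) → (ℤ → ℤ)
  | 0, z => z
  | n + 1, z => eMiter a1 a2 (idx ((n : ℤ) + 1)) (g ((n : ℤ) + 1)) (eMposChain g n z)

/-- `ePposChainO g n z = ẽ_{i_n}^{g n} ⋯ ẽ_{i_2}^{g 2} ẽ_{i_1}^{g 1} (z)` on `ℤ^{+∞}`. -/
noncomputable def ePposChainO (g : ℤ → ℕ) : ℕ → Option (ℤ → ℤ) → Option (ℤ → ℤ)
  | 0, z => z
  | n + 1, z => ePiterO a1 a2 (idx ((n : ℤ) + 1)) (g ((n : ℤ) + 1)) (ePposChainO g n z)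

/-- the Weyl group action `S_i` on `Z_ι(μ) ∪ {0}`. -/
noncomputable def SiO (μ : ℤ × ℤ) (i : ℤ) (ob : Option (ℤ → ℤ)) : Option (ℤ → ℤ) :=
  ob.bind fun b =>
    if 0 ≤ pairW (wtZ a1 a2 μ b) i then
      fZiterO a1 a2 μ i (pairW (wtZ a1 a2 μ b) i).toNat (some b)
    else eZiterO a1 a2 μ i (-(pairW (wtZ a1 a2 μ b) i)).toNat (some b)

/-- `SwPos μ n = S_{i_n} ⋯ S_{i_2} S_{i_1}`. -/
noncomputable def SwPos (μ : ℤ × ℤ) : ℕ → Option (ℤ → ℤ) → Option (ℤ → ℤ)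
  | 0, b => b
  | n + 1, b => SiO a1 a2 μ (idx ((n : ℤ) + 1)) (SwPos μ n b)

/-- `SwNeg μ n = S_{i_{-(n-1)}} ⋯ S_{i_{-1}} S_{i_0}`. -/
noncomputable def SwNeg (μ : ℤ × ℤ) : ℕ → Option (ℤ → ℤ) → Option (ℤ → ℤ)
  | 0, b => b
  | n + 1, b => SiO a1 a2 μ (idx (-(n : ℤ))) (SwNeg μ n b)

/-- `S_{w_k}`. -/
noncomputable def Swk (μ : ℤ × ℤ) (k : ℤ) (b : Option (ℤ → ℤ)) : Option (ℤ → ℤ) :=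
  if 0 ≤ k then SwPos a1 a2 μ k.toNat b else SwNeg a1 a2 μ (-k).toNat b

/-- `b ∈ Z_ι(μ)` is extremal. -/
noncomputable def Extremal (μ : ℤ × ℤ) (b : ℤ → ℤ) : Prop :=
  ∀ js : List ℤ, (∀ j ∈ js, IsI j) →
    ∃ b', js.foldr (SiO a1 a2 μ) (some b) = some b' ∧
      ∀ i : ℤ, IsI i →
        (0 ≤ pairW (wtZ a1 a2 μ b') i → eZ a1 a2 μ i b' = none) ∧
        (pairW (wtZ a1 a2 μ b') i ≤ 0 → fZ a1 a2 μ i b' = none)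

/-- `φ(x) ≥ 0` for all `φ ∈ Ξ_ι[λ]`. -/
noncomputable def SigmaCond (x : ℤ → ℤ) : Prop :=
  (0 ≤ gammaR a1 a2 0 * (pseq a1 a2 k1 k2 0 : ℝ) + gammaR a1 a2 0 * (x 0 : ℝ) - (x 1 : ℝ)) ∧
  (0 ≤ gammaR a1 a2 1 * (pseq a1 a2 k1 k2 1 : ℝ) + (x 0 : ℝ) - gammaR a1 a2 1 * (x 1 : ℝ)) ∧
  (∀ k : ℤ, 1 ≤ k → 0 ≤ (pseq a1 a2 k1 k2 k : ℝ) - (x k : ℝ)) ∧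
  (∀ k : ℤ, 1 ≤ k → 0 ≤ gammaR a1 a2 k * (x k : ℝ) - (x (k + 1) : ℝ)) ∧
  (∀ k : ℤ, 1 ≤ k → 0 ≤ gammaR a1 a2 (k + 1) * (pseq a1 a2 k1 k2 (k + 1) : ℝ) -
      (pseq a1 a2 k1 k2 k : ℝ) + (x k : ℝ) - gammaR a1 a2 (k + 1) * (x (k + 1) : ℝ)) ∧
  (∀ k : ℤ, k ≤ 0 → 0 ≤ (pseq a1 a2 k1 k2 k : ℝ) + (x k : ℝ)) ∧
  (∀ k : ℤ, k ≤ 0 → 0 ≤ (x (k - 1) : ℝ) - gammaR a1 a2 k * (x k : ℝ)) ∧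
  (∀ k : ℤ, k ≤ 0 → 0 ≤ gammaR a1 a2 (k - 1) * (pseq a1 a2 k1 k2 (k - 1) : ℝ) -
      (pseq a1 a2 k1 k2 k : ℝ) + gammaR a1 a2 (k - 1) * (x (k - 1) : ℝ) - (x k : ℝ))

/-- membership in `Σ_ι[λ]`. -/
noncomputable def SigmaMem (x : ℤ → ℤ) : Prop :=
  ZMem x ∧ SigmaCond a1 a2 k1 k2 x

/-- membership in `Σ'_ι[λ]`. -/
noncomputable def SigmaPrimeMem (x : ℤ → ℤ) : Prop :=
  SigmaMem a1 a2 k1 k2 x ∧ (∀ k : ℤ, k ≤ 0 → x k = 0) ∧ XPlusMem a1 a2 (posPart x)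

/-- evaluation of an affine function `φ = (c, (φ_l)_l)` at `x`. -/
noncomputable def evalAff (φ : ℝ × (ℤ → ℝ)) (x : ℤ → ℤ) : ℝ :=
  φ.1 + ∑ᶠ l : ℤ, φ.2 l * (x l : ℝ)

/-- `a_{i_k}`. -/
def aIdx (k : ℤ) : ℤ := if k % 2 = 1 then a1 else a2

/-- the affine function `b̄_k`. -/
noncomputable def bbar (lam : ℤ × ℤ) (k : ℤ) : ℝ × (ℤ → ℝ) :=
  ((if k = -1 ∨ k = 0 then -(pairW lam (idx k) : ℝ) else 0),
    fun l => (if l = k then (1 : ℝ) else 0) + (if l = k + 1 then -(aIdx a1 a2 k : ℝ) else 0) +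
      (if l = k + 2 then (1 : ℝ) else 0))

/-- the operator `S̄_k` on affine functions. -/
noncomputable def SbarOp (lam : ℤ × ℤ) (k : ℤ) (φ : ℝ × (ℤ → ℝ)) : ℝ × (ℤ → ℝ) :=
  let b := if 0 ≤ φ.2 k then bbar a1 a2 lam (k + 2) else bbar a1 a2 lam (k - 2)
  (φ.1 - φ.2 k * b.1, fun l => φ.2 l - φ.2 k * b.2 l)

end HypCrystal

namespace HypCrystal

section GammaLimit

variable {a1 a2 : ℤ}

theorem alphaR_pos (ha1 : 1 ≤ a1) (ha2 : 1 ≤ a2) : 0 < alphaR a1 a2 := by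
  have h1 : (1 : ℝ) ≤ a1 := by exact_mod_cast ha1
  have h2 : (1 : ℝ) ≤ a2 := by exact_mod_cast ha2
  unfold alphaR
  positivity

theorem betaR_pos (ha1 : 1 ≤ a1) (ha2 : 1 ≤ a2) : 0 < betaR a1 a2 := by
  have h1 : (1 : ℝ) ≤ a1 := by exact_mod_cast ha1
  have h2 : (1 : ℝ) ≤ a2 := by exact_mod_cast ha2
  unfold betaR
  positivity

theorem gammaR_pos (ha1 : 1 ≤ a1) (ha2 : 1 ≤ a2) (k : ℤ) : 0 < gammaR a1 a2 k := by
  unfold gammaR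
  split_ifs
  · exact alphaR_pos ha1 ha2
  · exact betaR_pos ha1 ha2

theorem mul_alphaR (ha1 : 1 ≤ a1) (ha2 : 1 ≤ a2) :
    (a2 : ℝ) * alphaR a1 a2 = a1 * betaR a1 a2 := by
  have h1 : (a1 : ℝ) ≠ 0 := by exact_mod_cast (by omega : a1 ≠ 0)
  have h2 : (a2 : ℝ) ≠ 0 := by exact_mod_cast (by omega : a2 ≠ 0)
  unfold alphaR betaR
  field_simp

theorem alphaR_mul_betaR (ha1 : 1 ≤ a1) (ha2 : 1 ≤ a2) (ha : 4 < a1 * a2) :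
    alphaR a1 a2 * betaR a1 a2 = a1 * betaR a1 a2 - 1 := by
  have h1 : (a1 : ℝ) ≠ 0 := by exact_mod_cast (by omega : a1 ≠ 0)
  have h2 : (a2 : ℝ) ≠ 0 := by exact_mod_cast (by omega : a2 ≠ 0)
  have h : (4 : ℝ) < a1 * a2 := by exact_mod_cast ha
  have hs : Real.sqrt ((a1 : ℝ) ^ 2 * (a2 : ℝ) ^ 2 - 4 * a1 * a2) ^ 2 =
      (a1 : ℝ) ^ 2 * (a2 : ℝ) ^ 2 - 4 * a1 * a2 := Real.sq_sqrt (by nlinarith)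
  unfold alphaR betaR
  generalize Real.sqrt _ = s at hs ⊢
  field_simp
  linear_combination hs

theorem one_lt_alphaR_mul_betaR (ha1 : 1 ≤ a1) (ha2 : 1 ≤ a2) (ha : 4 < a1 * a2) :
    1 < alphaR a1 a2 * betaR a1 a2 := by
  have h1 : (0 : ℝ) < a1 := by exact_mod_cast (by omega : 0 < a1)
  have h : (4 : ℝ) < a1 * a2 := by exact_mod_cast ha
  have hβ : (a1 : ℝ) * betaR a1 a2 =
      (a1 * a2 + Real.sqrt ((a1 : ℝ) ^ 2 * (a2 : ℝ) ^ 2 - 4 * a1 * a2)) / 2 := by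
    unfold betaR
    field_simp
  rw [alphaR_mul_betaR ha1 ha2 ha, hβ]
  linarith [Real.sqrt_nonneg ((a1 : ℝ) ^ 2 * (a2 : ℝ) ^ 2 - 4 * a1 * a2)]

theorem gammaR_mul_gammaR_succ (k : ℤ) :
    gammaR a1 a2 k * gammaR a1 a2 (k + 1) = alphaR a1 a2 * betaR a1 a2 := by
  unfold gammaR
  rcases Int.emod_two_eq_zero_or_one k with h | h
  · rw [if_pos h, if_neg (by omega)]
  · rw [if_neg (by omega), if_pos (by omega), mul_comm]

variable (a1 a2) in
/-- The difference `c_{n+1} − γ_{n+1}·c_n`. -/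
noncomputable def cseqGap (n : ℕ) : ℝ :=
  (cseq a1 a2 (n + 1) : ℝ) - gammaR a1 a2 ((n : ℤ) + 1) * (cseq a1 a2 n : ℝ)

theorem gammaR_mul_cseqGap_succ (ha1 : 1 ≤ a1) (ha2 : 1 ≤ a2) (ha : 4 < a1 * a2) (n : ℕ) :
    gammaR a1 a2 ((n : ℤ) + 1) * cseqGap a1 a2 (n + 1) = cseqGap a1 a2 n := by
  have hαβ := alphaR_mul_betaR ha1 ha2 ha
  have hβα := mul_alphaR ha1 ha2
  unfold cseqGap
  rw [cseq]
  unfold gammaR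
  rcases Nat.mod_two_eq_zero_or_one n with h | h
  · rw [if_pos h, if_neg (by omega), if_pos (by omega)]
    push_cast
    linear_combination (-(cseq a1 a2 (n + 1) : ℝ)) * hαβ
  · rw [if_neg (show ¬ n % 2 = 0 by omega), if_pos (by omega), if_neg (by omega)]
    push_cast
    linear_combination (-(cseq a1 a2 (n + 1) : ℝ)) * hαβ + (cseq a1 a2 (n + 1) : ℝ) * hβα

theorem cseqGap_pos (ha1 : 1 ≤ a1) (ha2 : 1 ≤ a2) (ha : 4 < a1 * a2) (n : ℕ) :
    0 < cseqGap a1 a2 n := by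
  induction n with
  | zero => simp [cseqGap, cseq]
  | succ n ih =>
    rw [← gammaR_mul_cseqGap_succ ha1 ha2 ha n] at ih
    exact pos_of_mul_pos_right ih (gammaR_pos ha1 ha2 _).le

theorem cseqGap_add_two_mul (ha1 : 1 ≤ a1) (ha2 : 1 ≤ a2) (ha : 4 < a1 * a2) (n l : ℕ) :
    (alphaR a1 a2 * betaR a1 a2) ^ l * cseqGap a1 a2 (n + 2 * l) = cseqGap a1 a2 n := by
  induction l with
  | zero => simp
  | succ l ih =>
    have h1 := gammaR_mul_cseqGap_succ ha1 ha2 ha (n + 2 * l)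
    have h2 := gammaR_mul_cseqGap_succ ha1 ha2 ha (n + 2 * l + 1)
    have hγ := gammaR_mul_gammaR_succ (a1 := a1) (a2 := a2) (((n + 2 * l : ℕ) : ℤ) + 1)
    rw [← ih, ← h1, ← h2, ← hγ, show n + 2 * (l + 1) = n + 2 * l + 1 + 1 by ring]
    push_cast
    ring

theorem cseq_pos (ha1 : 1 ≤ a1) (ha2 : 1 ≤ a2) (ha : 4 < a1 * a2) (n : ℕ) :
    0 < cseq a1 a2 (n + 1) := by
  induction n with
  | zero => simp [cseq]
  | succ n ih =>
    have hgap := cseqGap_pos ha1 ha2 ha (n + 1)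
    have hc : (0 : ℝ) < cseq a1 a2 (n + 1) := by exact_mod_cast ih
    have := mul_pos (gammaR_pos ha1 ha2 (((n + 1 : ℕ) : ℤ) + 1)) hc
    unfold cseqGap at hgap
    have : (0 : ℝ) < cseq a1 a2 (n + 1 + 1) := by linarith
    exact_mod_cast this

theorem gammaR_add_two_mul (k l : ℤ) : gammaR a1 a2 (k + 2 * l) = gammaR a1 a2 k := by
  unfold gammaR
  rw [Int.add_mul_emod_self_left]

/-- For `y ≥ 0`, the inequalities `c_{n+2l+1}·y ≥ c_{n+2l}·z` for all `l ≥ 1` amount to their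
limit `γ_{n+1}·y ≥ z`. -/
theorem forall_cseq_ineq_iff (ha1 : 1 ≤ a1) (ha2 : 1 ≤ a2) (ha : 4 < a1 * a2) (n : ℕ)
    {y z : ℤ} (hy : 0 ≤ y) :
    (∀ l : ℕ, 1 ≤ l → 0 ≤ cseq a1 a2 (n + 2 * l + 1) * y - cseq a1 a2 (n + 2 * l) * z) ↔
      0 ≤ gammaR a1 a2 ((n : ℤ) + 1) * (y : ℝ) - (z : ℝ) := by
  have hyR : (0 : ℝ) ≤ y := by exact_mod_cast hy
  have key (l : ℕ) : ((cseq a1 a2 (n + 2 * l + 1) * y - cseq a1 a2 (n + 2 * l) * z : ℤ) : ℝ) =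
      cseqGap a1 a2 (n + 2 * l) * y +
        cseq a1 a2 (n + 2 * l) * (gammaR a1 a2 ((n : ℤ) + 1) * y - z) := by
    have hγ : gammaR a1 a2 (((n + 2 * l : ℕ) : ℤ) + 1) = gammaR a1 a2 ((n : ℤ) + 1) := by
      rw [← gammaR_add_two_mul ((n : ℤ) + 1) l]
      congr 1
      push_cast
      ring
    unfold cseqGap
    rw [hγ]
    push_cast
    ring
  have hc (l : ℕ) (hl : 1 ≤ l) : (1 : ℝ) ≤ cseq a1 a2 (n + 2 * l) := by
    have := cseq_pos ha1 ha2 ha (n + 2 * l - 1)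
    rw [show n + 2 * l - 1 + 1 = n + 2 * l by omega] at this
    exact_mod_cast this
  constructor
  · intro h
    by_contra! hneg
    obtain ⟨l, hl⟩ := pow_unbounded_of_one_lt
      (cseqGap a1 a2 n * y / -(gammaR a1 a2 ((n : ℤ) + 1) * y - z))
      (one_lt_alphaR_mul_betaR ha1 ha2 ha)
    rw [div_lt_iff₀ (by linarith)] at hl
    have hρ := one_lt_alphaR_mul_betaR ha1 ha2 ha
    have hl' : cseqGap a1 a2 n * y < (alphaR a1 a2 * betaR a1 a2) ^ (l + 1) *
        -(gammaR a1 a2 ((n : ℤ) + 1) * y - z) :=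
      hl.trans_le (mul_le_mul_of_nonneg_right (pow_le_pow_right₀ hρ.le l.le_succ) (by linarith))
    rw [← cseqGap_add_two_mul ha1 ha2 ha n (l + 1), mul_assoc] at hl'
    have hlt := lt_of_mul_lt_mul_left hl' (pow_nonneg (by linarith) _)
    have hnn : (0 : ℝ) ≤ _ := Int.cast_nonneg (h (l + 1) (by omega))
    rw [key] at hnn
    nlinarith [hc (l + 1) (by omega)]
  · intro h l hl
    have : (0 : ℝ) ≤ _ := add_nonneg (mul_nonneg (cseqGap_pos ha1 ha2 ha (n + 2 * l)).le hyR)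
      (mul_nonneg (zero_le_one.trans (hc l hl)) h)
    rw [← key] at this
    exact_mod_cast this

end GammaLimit

end HypCrystal

open HypCrystal in
theorem cseq_ineq_iff_gamma_ineq
    (a1 a2 : ℤ) (ha1 : 1 ≤ a1) (ha2 : 1 ≤ a2) (ha : 4 < a1 * a2)
    (k1 k2 : ℤ) (hk1 : 0 < k1) (hk2 : 0 < k2)
    (hreg : 2 ≤ a1 → 2 ≤ a2 →
      (k2 ≤ k1 ∧ k1 < (a1 - 1) * k2) ∨ (k1 < k2 ∧ k2 ≤ (a2 - 1) * k1))
    (hdeg1 : a1 = 1 → 2 * k1 ≤ k2 ∧ k2 ≤ (a2 - 2) * k1)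
    (hdeg2 : a2 = 1 → 2 * k2 ≤ k1 ∧ k1 ≤ (a1 - 2) * k2)
    (x : ℤ → ℤ) (hx : XPlusMem a1 a2 x)
    (hxp : ∀ m : ℤ, 1 ≤ m → x m ≤ pseq a1 a2 k1 k2 m)
    (k : ℤ) (hk : 1 ≤ k) :
    (∀ l : ℤ, 1 ≤ l →
        0 ≤ cseq a1 a2 (k + 2 * l).toNat * x k - cseq a1 a2 (k + 2 * l - 1).toNat * x (k + 1)) ↔
      0 ≤ gammaR a1 a2 k * (x k : ℝ) - (x (k + 1) : ℝ) := by
  obtain ⟨n, rfl⟩ : ∃ n : ℕ, k = (n : ℤ) + 1 := ⟨(k - 1).toNat, by omega⟩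
  rw [← forall_cseq_ineq_iff ha1 ha2 ha n (hx.1.2.1 _)]
  have e1 (l : ℕ) : ((n : ℤ) + 1 + 2 * l).toNat = n + 2 * l + 1 := by omega
  have e2 (l : ℕ) : ((n : ℤ) + 1 + 2 * l - 1).toNat = n + 2 * l := by omega
  constructor
  · intro h l hl
    have := h l (by exact_mod_cast hl)
    rwa [e1, e2] at this
  · intro h l hl
    lift l to ℕ using by omega
    rw [e1, e2]
    exact h l (by exact_mod_cast hl)
end

section
/- Σ_ι[λ] ⊆ X+ ⊗ t_λ ⊗ X−; that is, for every x = x⁺ ⊗ t_λ ⊗ x⁻ ∈ Σ_ι[λ] one has x⁺ ∈ X+ and x⁻ ∈ X− (equivalently, c_j·x_j − c_{j−1}·x_{j+1} ≥ 0 for all j ≥ 1 and c'_{−j+1}·x_j − c'_{−j}·x_{j−1} ≤ 0 for all j ≤ 0). -/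
open Filter Function

namespace HypCrystal

variable (a1 a2 k1 k2 : ℤ)

section GammaRatio

variable {a1 a2 : ℤ}

theorem alphaR_nonneg (ha1 : 0 < a1) (ha2 : 0 < a2) : 0 ≤ alphaR a1 a2 := by
  have h1 : (0 : ℝ) < a1 := by exact_mod_cast ha1
  have h2 : (0 : ℝ) < a2 := by exact_mod_cast ha2
  unfold alphaR
  positivity

theorem betaR_eq_alphaR_swap (a1 a2 : ℤ) : betaR a1 a2 = alphaR a2 a1 := by
  unfold betaR alphaR
  ring_nf

theorem sub_alphaR_mul_betaR (ha1 : 0 < a1) (ha2 : 0 < a2) (ha : 4 ≤ a1 * a2) :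
    ((a1 : ℝ) - alphaR a1 a2) * betaR a1 a2 = 1 := by
  have h1 : (0 : ℝ) < a1 := by exact_mod_cast ha1
  have h2 : (0 : ℝ) < a2 := by exact_mod_cast ha2
  have h : (4 : ℝ) ≤ a1 * a2 := by exact_mod_cast ha
  have hdisc : (0 : ℝ) ≤ (a1 : ℝ) ^ 2 * (a2 : ℝ) ^ 2 - 4 * a1 * a2 := by
    nlinarith [mul_pos h1 h2]
  have hsq := Real.sq_sqrt hdisc
  unfold alphaR betaR
  set r := Real.sqrt ((a1 : ℝ) ^ 2 * (a2 : ℝ) ^ 2 - 4 * a1 * a2)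
  field_simp
  linear_combination -hsq

theorem gammaR_swap (a1 a2 : ℤ) (k : ℤ) : gammaR a2 a1 (k + 1) = gammaR a1 a2 k := by
  unfold gammaR
  rw [betaR_eq_alphaR_swap, betaR_eq_alphaR_swap]
  rcases Int.emod_two_eq_zero_or_one k with hk | hk
  · rw [if_neg (by omega), if_pos hk]
  · rw [if_pos (by omega), if_neg (by omega)]

theorem gammaR_nonneg (ha1 : 0 < a1) (ha2 : 0 < a2) (k : ℤ) : 0 ≤ gammaR a1 a2 k := by
  unfold gammaR
  split_ifs
  · exact alphaR_nonneg ha1 ha2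
  · rw [betaR_eq_alphaR_swap]
    exact alphaR_nonneg ha2 ha1

theorem gammaR_recurrence (ha1 : 0 < a1) (ha2 : 0 < a2) (ha : 4 ≤ a1 * a2) (n : ℕ) :
    (((if n % 2 = 0 then a1 else a2 : ℤ) : ℝ) - gammaR a1 a2 n) * gammaR a1 a2 (n + 1) = 1 := by
  unfold gammaR
  rcases Nat.mod_two_eq_zero_or_one n with hn | hn
  · rw [if_pos hn, if_pos (by omega), if_neg (by omega)]
    exact sub_alphaR_mul_betaR ha1 ha2 ha
  · rw [if_neg (by omega), if_neg (by omega), if_pos (by omega), betaR_eq_alphaR_swap,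
      ← betaR_eq_alphaR_swap a2 a1]
    exact sub_alphaR_mul_betaR ha2 ha1 (by rwa [mul_comm])

theorem cseq_nonneg_and_gammaR_mul_le (ha1 : 0 < a1) (ha2 : 0 < a2) (ha : 4 ≤ a1 * a2) (n : ℕ) :
    0 ≤ (cseq a1 a2 n : ℝ) ∧
      gammaR a1 a2 (n + 1) * (cseq a1 a2 n : ℝ) ≤ (cseq a1 a2 (n + 1) : ℝ) := by
  induction n with
  | zero => simp [cseq]
  | succ n ih =>
    obtain ⟨hc, hle⟩ := ih
    have hγ := gammaR_nonneg ha1 ha2 ((n : ℤ) + 1)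
    have hrec := gammaR_recurrence ha1 ha2 ha n
    have hc' : 0 ≤ (cseq a1 a2 (n + 1) : ℝ) := (mul_nonneg hγ hc).trans hle
    refine ⟨hc', ?_⟩
    have hper : gammaR a1 a2 (((n + 1 : ℕ) : ℤ) + 1) = gammaR a1 a2 n := by
      rw [← gammaR_swap a1 a2 n, ← gammaR_swap a2 a1]
      push_cast
      rfl
    rw [hper, cseq]
    push_cast
    have hpos : 0 < gammaR a1 a2 ((n : ℤ) + 1) :=
      hγ.lt_of_ne fun h => by rw [← h] at hrec; simp at hrec
    refine le_of_mul_le_mul_left ?_ hpos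
    push_cast at hrec
    linear_combination hle - (cseq a1 a2 (n + 1) : ℝ) * hrec

theorem cseq'_eq_cseq_swap (a1 a2 : ℤ) : ∀ n : ℕ, cseq' a1 a2 n = cseq a2 a1 n
  | 0 => rfl
  | 1 => rfl
  | n + 2 => by rw [cseq', cseq, cseq'_eq_cseq_swap a1 a2 n, cseq'_eq_cseq_swap a1 a2 (n + 1)]

end GammaRatio

end HypCrystal

open HypCrystal in
theorem sigmaMem_subset_XX
    (a1 a2 : ℤ) (ha1 : 1 ≤ a1) (ha2 : 1 ≤ a2) (ha : 4 < a1 * a2)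
    (k1 k2 : ℤ) (hk1 : 0 < k1) (hk2 : 0 < k2)
    (hreg : 2 ≤ a1 → 2 ≤ a2 →
      (k2 ≤ k1 ∧ k1 < (a1 - 1) * k2) ∨ (k1 < k2 ∧ k2 ≤ (a2 - 1) * k1))
    (hdeg1 : a1 = 1 → 2 * k1 ≤ k2 ∧ k2 ≤ (a2 - 2) * k1)
    (hdeg2 : a2 = 1 → 2 * k2 ≤ k1 ∧ k1 ≤ (a1 - 2) * k2)
    (x : ℤ → ℤ) (hxZ : ZMem x) (hxS : SigmaCond a1 a2 k1 k2 x) :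
    (∀ j : ℤ, 1 ≤ j →
        0 ≤ cseq a1 a2 j.toNat * x j - cseq a1 a2 (j - 1).toNat * x (j + 1)) ∧
    (∀ j : ℤ, j ≤ 0 →
        cseq' a1 a2 (1 - j).toNat * x j - cseq' a1 a2 (-j).toNat * x (j - 1) ≤ 0) := by
  have hpos1 : 0 < a1 := ha1
  have hpos2 : 0 < a2 := ha2
  obtain ⟨⟨-, hxp, -⟩, -, hxm, -⟩ := hxZ
  obtain ⟨-, -, -, hup, -, -, hdown, -⟩ := hxS
  refine ⟨fun j hj => ?_, fun j hj => ?_⟩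
  · obtain ⟨n, rfl⟩ : ∃ n : ℕ, j = n + 1 := ⟨(j - 1).toNat, by omega⟩
    have hx : 0 ≤ x (n + 1) := by simpa [HypCrystal.posPart, hj] using hxp (n + 1)
    have hxR : (0 : ℝ) ≤ x (n + 1) := by exact_mod_cast hx
    have hγ := hup _ hj
    obtain ⟨hc, hle⟩ := cseq_nonneg_and_gammaR_mul_le hpos1 hpos2 ha.le n
    rw [show ((n : ℤ) + 1).toNat = n + 1 by omega, show ((n : ℤ) + 1 - 1).toNat = n by omega]
    rify
    linear_combination mul_nonneg hc hγ + mul_le_mul_of_nonneg_right hle hxR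
  · obtain ⟨n, rfl⟩ : ∃ n : ℕ, j = -n := ⟨(-j).toNat, by omega⟩
    have hx : x (-n) ≤ 0 := by simpa [HypCrystal.negPart, hj] using hxm (-n)
    have hxR : (x (-n) : ℝ) ≤ 0 := by exact_mod_cast hx
    have hγ := hdown _ hj
    obtain ⟨hc, hle⟩ := cseq_nonneg_and_gammaR_mul_le hpos2 hpos1 (by linarith) n
    have hpar : gammaR a1 a2 (-n) = gammaR a1 a2 n := by
      unfold gammaR
      rw [Int.neg_emod_two]
    rw [hpar] at hγ
    rw [gammaR_swap] at hle
    rw [show (1 - -(n : ℤ)).toNat = n + 1 by omega, show (-(-(n : ℤ))).toNat = n by omega,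
      cseq'_eq_cseq_swap, cseq'_eq_cseq_swap]
    rify
    linear_combination mul_nonneg hc hγ + mul_le_mul_of_nonpos_right hle hxR
end
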